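/- arXiv:2404.16639 — 2 statements merged into one kernel-verified Lean document; each statement's English description precedes it below -/
import Mathlib

section
/- Let M be a finitely generated free ℤ-module and σ a ℤ-linear automorphism of M of finite order. Then there exist an integer m ≥ 0, positive integers r_1, …, r_m, primitive r_i-th roots of unity ζ_{r_i} in the rings of integers 𝓞_{r_i} = ℤ[ζ_{r_i}] of the cyclotomic fields ℚ(ζ_{r_i}), and an injective ℤ-linear map F : ⨁_{i=1}^m 𝓞_{r_i} → M with finite cokernel such that F((ζ_{r_i} · x_i)_{i}) = σ(F((x_i)_i)) for all (x_i)_i ∈ ⨁_{i=1}^m 𝓞_{r_i}. In other words, every free Γ-module is isogenous to a finite direct sum of modules ℤ[ζ_r] with the Frobenius generator acting by multiplication by ζ_r. -/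
open Polynomial NumberField

instance CyclotomicField.isCyclotomicExtension_pnat (r : ℕ+) :
    IsCyclotomicExtension {(r : ℕ)} ℚ (CyclotomicField r ℚ) :=
  haveI : NeZero ((r : ℕ) : ℚ) := ⟨by exact_mod_cast r.ne_zero⟩
  CyclotomicField.isCyclotomicExtension (r : ℕ) ℚ

/-- A fixed primitive `r`-th root of unity in the ring of integers of the `r`-th cyclotomic
field. -/
noncomputable def cyclotomicInteger (r : ℕ+) : 𝓞 (CyclotomicField r ℚ) :=
  (IsCyclotomicExtension.zeta_spec (r : ℕ) ℚ (CyclotomicField r ℚ)).toInteger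

lemma isPrimitiveRoot_cyclotomicInteger (r : ℕ+) :
    IsPrimitiveRoot (cyclotomicInteger r) (r : ℕ) :=
  (IsCyclotomicExtension.zeta_spec (r : ℕ) ℚ (CyclotomicField r ℚ)).toInteger_isPrimitiveRoot

lemma aeval_cyclotomicInteger_surjective (r : ℕ+) :
    Function.Surjective (aeval (R := ℤ) (cyclotomicInteger r)) := fun y => by
  obtain ⟨f, hf⟩ := (IsCyclotomicExtension.zeta_spec (r : ℕ) ℚ
    (CyclotomicField r ℚ)).integralPowerBasis.exists_eq_aeval' y
  rw [IsPrimitiveRoot.integralPowerBasis_gen] at hf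
  exact ⟨f, hf.symm⟩

lemma cyclotomic_dvd_of_aeval_cyclotomicInteger_eq_zero (r : ℕ+) {f : ℤ[X]}
    (hf : aeval (cyclotomicInteger r) f = 0) : cyclotomic r ℤ ∣ f := by
  have hζ := IsCyclotomicExtension.zeta_spec (r : ℕ) ℚ (CyclotomicField r ℚ)
  rw [cyclotomic_eq_minpoly hζ r.pos]
  refine minpoly.isIntegrallyClosed_dvd (hζ.isIntegral r.pos) ?_
  have h := congrArg (algebraMap (𝓞 (CyclotomicField r ℚ)) (CyclotomicField r ℚ)) hf
  rwa [← aeval_algebraMap_apply, map_zero] at h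

section

variable {M : Type*} [AddCommGroup M] (φ : Module.End ℤ M)

lemma aeval_mem_of_forall_mem {N : Submodule ℤ M} (hN : ∀ x ∈ N, φ x ∈ N) (f : ℤ[X]) {x : M}
    (hx : x ∈ N) : aeval φ f x ∈ N := by
  induction f using Polynomial.induction_on' with
  | add p q hp hq => simpa using N.add_mem hp hq
  | monomial n a =>
    have h : ∀ k, (φ ^ k) x ∈ N := fun k => by
      induction k with
      | zero => simpa using hx
      | succ k ih => rw [pow_succ']; exact hN _ ih
    simpa [aeval_monomial] using N.smul_mem a (h n)

/-- If no nonzero multiple of `w` lies in the `φ`-stable submodule `N`, then `f(φ) w ∈ N` only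
for those `f` vanishing at the primitive root of unity. -/
lemma aeval_cyclotomicInteger_eq_zero_of_aeval_mem {N : Submodule ℤ M}
    (hN : ∀ x ∈ N, φ x ∈ N) {r : ℕ+} {w : M} (hw : aeval φ (cyclotomic r ℤ) w = 0)
    (hwN : ∀ c : ℤ, c ≠ 0 → c • w ∉ N) {f : ℤ[X]} (hf : aeval φ f w ∈ N) :
    aeval (cyclotomicInteger r) f = 0 := by
  by_contra h0
  obtain ⟨c, hc, z, hz⟩ := (Algebra.IsAlgebraic.isAlgebraic (R := ℤ)
    (aeval (cyclotomicInteger r) f)).exists_nonzero_dvd (mem_nonZeroDivisors_of_ne_zero h0)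
  obtain ⟨g, rfl⟩ := aeval_cyclotomicInteger_surjective r z
  obtain ⟨q, hq⟩ := cyclotomic_dvd_of_aeval_cyclotomicInteger_eq_zero r
    (f := C c - g * f) (by rw [map_sub, aeval_C, hz, map_mul, mul_comm, sub_self])
  refine hwN c hc ?_
  have h : aeval φ (C c) w = aeval φ g (aeval φ f w) := by
    rw [← Module.End.mul_apply, ← map_mul, ← sub_eq_zero, ← LinearMap.sub_apply, ← map_sub, hq,
      mul_comm, map_mul, Module.End.mul_apply, hw, map_zero]
  rw [aeval_C, Module.algebraMap_end_apply] at h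
  rw [h]
  exact aeval_mem_of_forall_mem φ hN g hf

/-- An element `w` killed by `Φ_r(φ)`, none of whose nonzero multiples lies in the `φ`-stable
submodule `N`, generates a copy of `ℤ[ζ_r]` meeting `N` trivially. -/
lemma exists_linearMap_ringOfIntegers {N : Submodule ℤ M}
    (hN : ∀ x ∈ N, φ x ∈ N) {r : ℕ+} {w : M} (hw : aeval φ (cyclotomic r ℤ) w = 0)
    (hwN : ∀ c : ℤ, c ≠ 0 → c • w ∉ N) :
    ∃ L : 𝓞 (CyclotomicField r ℚ) →ₗ[ℤ] M, L 1 = w ∧ (∀ y, L y ∈ N → y = 0) ∧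
      ∀ y, L (cyclotomicInteger r * y) = φ (L y) := by
  let π : ℤ[X] →ₗ[ℤ] 𝓞 (CyclotomicField r ℚ) := (aeval (cyclotomicInteger r)).toLinearMap
  let T : ℤ[X] →ₗ[ℤ] M := (LinearMap.applyₗ w).comp (aeval φ).toLinearMap
  have hπ : Function.Surjective π := aeval_cyclotomicInteger_surjective r
  have hker : LinearMap.ker π ≤ LinearMap.ker T := fun f hf => by
    obtain ⟨q, rfl⟩ := cyclotomic_dvd_of_aeval_cyclotomicInteger_eq_zero r hf
    change aeval φ (cyclotomic r ℤ * q) w = 0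
    rw [mul_comm, map_mul, Module.End.mul_apply, hw, map_zero]
  let L := ((LinearMap.ker π).liftQ T hker).comp (π.quotKerEquivOfSurjective hπ).symm.toLinearMap
  have hL : ∀ f, L (aeval (cyclotomicInteger r) f) = aeval φ f w := fun f => by
    change (LinearMap.ker π).liftQ T hker ((π.quotKerEquivOfSurjective hπ).symm (π f)) = _
    rw [LinearMap.quotKerEquivOfSurjective_symm_apply]
    rfl
  refine ⟨L, by simpa using hL 1, fun y hy => ?_, fun y => ?_⟩
  · obtain ⟨f, rfl⟩ := aeval_cyclotomicInteger_surjective r y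
    rw [hL] at hy
    exact aeval_cyclotomicInteger_eq_zero_of_aeval_mem φ hN hw hwN hy
  · obtain ⟨f, rfl⟩ := aeval_cyclotomicInteger_surjective r y
    have h := hL (X * f)
    rwa [map_mul (aeval _), map_mul (aeval φ), aeval_X, aeval_X, Module.End.mul_apply, ← hL f] at h

/-- If `φ ^ n = 1` and every element killed by some `Φ_d(φ)` has a nonzero multiple in `N`, then
so does every element. -/
lemma exists_smul_mem_of_forall_cyclotomic {N : Submodule ℤ M} {n : ℕ} (hn : 0 < n)
    (hφ : φ ^ n = 1)
    (h : ∀ (r : ℕ+) (w : M), aeval φ (cyclotomic r ℤ) w = 0 → ∃ c : ℤ, c ≠ 0 ∧ c • w ∈ N)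
    (v : M) : ∃ c : ℤ, c ≠ 0 ∧ c • v ∈ N := by
  classical
  have hprod := prod_cyclotomic_eq_X_pow_sub_one hn ℤ
  have hderiv := congrArg derivative hprod
  rw [derivative_prod_finset] at hderiv
  have hsum : (n : ℤ) • v = ∑ d ∈ n.divisors,
      aeval φ ((∏ b ∈ n.divisors.erase d, cyclotomic b ℤ) * derivative (cyclotomic d ℤ) * X) v := by
    rw [← LinearMap.sum_apply, ← map_sum, ← Finset.sum_mul, hderiv]
    have hX : derivative (X ^ n - 1 : ℤ[X]) * X = C (n : ℤ) * X ^ n := by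
      simp [derivative_X_pow, mul_assoc, pow_sub_one_mul hn.ne']
    rw [hX, map_mul, aeval_C, map_pow, aeval_X, hφ, mul_one, Module.algebraMap_end_apply]
  have hterm : ∀ d ∈ n.divisors, ∃ c : ℤ, c ≠ 0 ∧ c • aeval φ
      ((∏ b ∈ n.divisors.erase d, cyclotomic b ℤ) * derivative (cyclotomic d ℤ) * X) v ∈ N := by
    intro d hd
    refine h ⟨d, Nat.pos_of_mem_divisors hd⟩ _ ?_
    rw [← Module.End.mul_apply, ← map_mul, PNat.mk_coe, ← mul_assoc, ← mul_assoc,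
      Finset.mul_prod_erase _ (fun b => cyclotomic b ℤ) hd, hprod, mul_assoc, map_mul, map_sub,
      map_pow, aeval_X, hφ, map_one, sub_self, zero_mul, LinearMap.zero_apply]
  choose! c hc0 hc using hterm
  refine ⟨(∏ d ∈ n.divisors, c d) * n,
    mul_ne_zero (Finset.prod_ne_zero_iff.mpr hc0) (by exact_mod_cast hn.ne'), ?_⟩
  rw [mul_smul, hsum, Finset.smul_sum]
  refine N.sum_mem fun d hd => ?_
  rw [← Finset.prod_erase_mul _ _ hd, mul_smul]
  exact N.smul_mem _ (hc d hd)

/-- A submodule is a cyclotomic sum if it is the image of an injective equivariant map from a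
finite direct sum of rings `ℤ[ζ_r]`. -/
def IsCyclotomicSum (N : Submodule ℤ M) : Prop :=
  ∃ (m : ℕ) (r : Fin m → ℕ+) (F : ((i : Fin m) → 𝓞 (CyclotomicField (r i) ℚ)) →ₗ[ℤ] M),
    Function.Injective F ∧ (∀ x, F (fun i => cyclotomicInteger (r i) * x i) = φ (F x)) ∧
      LinearMap.range F = N

variable {φ}

lemma isCyclotomicSum_bot : IsCyclotomicSum φ (⊥ : Submodule ℤ M) :=
  ⟨0, Fin.elim0, 0, Function.injective_of_subsingleton _, by simp, LinearMap.range_zero⟩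

lemma IsCyclotomicSum.apply_mem {N : Submodule ℤ M} (hN : IsCyclotomicSum φ N) :
    ∀ x ∈ N, φ x ∈ N := by
  obtain ⟨m, r, F, -, hF, rfl⟩ := hN
  rintro _ ⟨x, rfl⟩
  exact ⟨_, hF x⟩

lemma IsCyclotomicSum.exists_lt {N : Submodule ℤ M} (hN : IsCyclotomicSum φ N) {r : ℕ+} {w : M}
    (hw : aeval φ (cyclotomic r ℤ) w = 0) (hwN : ∀ c : ℤ, c ≠ 0 → c • w ∉ N) :
    ∃ N', IsCyclotomicSum φ N' ∧ N < N' := by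
  obtain ⟨L, hL1, hL, hLφ⟩ := exists_linearMap_ringOfIntegers φ hN.apply_mem hw hwN
  obtain ⟨m, s, F, hinj, hF, rfl⟩ := hN
  let s' : Fin (m + 1) → ℕ+ := Fin.cons r s
  let tail : ((i : Fin (m + 1)) → 𝓞 (CyclotomicField (s' i) ℚ)) →ₗ[ℤ]
      ((i : Fin m) → 𝓞 (CyclotomicField (s i) ℚ)) :=
    { toFun := fun x i => x i.succ, map_add' := fun _ _ => rfl, map_smul' := fun _ _ => rfl }
  let head : ((i : Fin (m + 1)) → 𝓞 (CyclotomicField (s' i) ℚ)) →ₗ[ℤ]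
      𝓞 (CyclotomicField r ℚ) :=
    { toFun := fun x => x 0, map_add' := fun _ _ => rfl, map_smul' := fun _ _ => rfl }
  let F' := L.comp head + F.comp tail
  have hF' : ∀ x, F' x = L (head x) + F (tail x) := fun _ => rfl
  refine ⟨LinearMap.range F', ⟨m + 1, s', F', ?_, fun x => ?_, rfl⟩, ?_⟩
  · rw [injective_iff_map_eq_zero]
    intro x hx
    rw [hF'] at hx
    have h0 : head x = 0 := by
      apply hL
      rw [eq_neg_of_add_eq_zero_left hx]
      exact Submodule.neg_mem _ ⟨_, rfl⟩
    rw [h0, map_zero, zero_add] at hx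
    have h1 : tail x = 0 := (injective_iff_map_eq_zero F).mp hinj _ hx
    funext i
    refine Fin.cases ?_ (fun j => ?_) i
    · exact h0
    · exact congrFun h1 j
  · rw [hF', hF', map_add, ← hLφ, ← hF]
    rfl
  · have hcons : ∀ a y, ∃ x, F' x = L a + F y := fun a y =>
      ⟨fun i => Fin.cases (motive := fun i => 𝓞 (CyclotomicField (s' i) ℚ)) a y i, rfl⟩
    refine lt_of_le_of_ne ?_ fun h => hwN 1 one_ne_zero ?_
    · rintro _ ⟨y, rfl⟩
      obtain ⟨x, hx⟩ := hcons 0 y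
      exact ⟨x, by rw [hx, map_zero, zero_add]⟩
    · obtain ⟨x, hx⟩ := hcons 1 0
      rw [h, one_smul]
      exact ⟨x, by rw [hx, map_zero, add_zero, hL1]⟩

end

/-- The isogeny theorem for the canonical `ℤ`-module structure on an abelian group. -/
lemma exists_isogeny_of_pow_eq_one {M : Type*} [AddCommGroup M] [Module.Finite ℤ M]
    (σ : M ≃ₗ[ℤ] M) (hσ : ∃ n : ℕ, 0 < n ∧ σ ^ n = 1) :
    ∃ (m : ℕ) (r : Fin m → ℕ+)
      (ζ : (i : Fin m) → NumberField.RingOfIntegers (CyclotomicField (r i) ℚ)),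
      (∀ i, IsPrimitiveRoot (ζ i) (r i : ℕ)) ∧
      ∃ F : ((i : Fin m) → NumberField.RingOfIntegers (CyclotomicField (r i) ℚ)) →ₗ[ℤ] M,
        Function.Injective F ∧ Finite (M ⧸ LinearMap.range F) ∧
        ∀ x, F (fun i => ζ i * x i) = σ (F x) := by
  obtain ⟨n, hn, hσn⟩ := hσ
  have hφ : (σ : Module.End ℤ M) ^ n = 1 := by
    ext x
    have h := congrArg (fun τ : M ≃ₗ[ℤ] M => τ x) hσn
    simpa [Module.End.pow_apply, LinearEquiv.pow_apply] using h
  obtain ⟨N, hN, hmax⟩ := set_has_maximal_iff_noetherian.mpr (inferInstance : IsNoetherian ℤ M)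
    {N | IsCyclotomicSum (σ : Module.End ℤ M) N} ⟨⊥, isCyclotomicSum_bot⟩
  have htors : ∀ v, ∃ c : ℤ, c ≠ 0 ∧ c • v ∈ N := by
    refine exists_smul_mem_of_forall_cyclotomic _ hn hφ fun r w hw => ?_
    by_contra! h
    obtain ⟨N', hN', hlt⟩ := IsCyclotomicSum.exists_lt hN hw h
    exact hmax N' hN' hlt
  obtain ⟨m, r, F, hinj, hF, rfl⟩ := hN
  refine ⟨m, r, fun i => cyclotomicInteger (r i), fun i => isPrimitiveRoot_cyclotomicInteger _,
    F, hinj, Module.finite_of_fg_torsion _ fun {x} => ?_, hF⟩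
  obtain ⟨v, rfl⟩ := Submodule.Quotient.mk_surjective _ x
  obtain ⟨c, hc, hcv⟩ := htors v
  exact ⟨⟨c, mem_nonZeroDivisors_of_ne_zero hc⟩, (Submodule.Quotient.mk_eq_zero _).mpr hcv⟩

/-- Every free `Γ`-module (a finitely generated free `ℤ`-module `M` with a
finite-order `ℤ`-linear automorphism `σ`) is isogenous to a finite direct sum of the rings of
integers `ℤ[ζ_{r_i}]` of cyclotomic fields, the automorphism acting by multiplication by the
primitive roots of unity `ζ_{r_i}`: there is an injective equivariant `ℤ`-linear map with
finite cokernel from the direct sum to `M`. -/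
theorem stmt_4 {M : Type*} [AddCommGroup M] [Module ℤ M]
    [Module.Free ℤ M] [Module.Finite ℤ M]
    (σ : M ≃ₗ[ℤ] M) (hσ : ∃ n : ℕ, 0 < n ∧ σ ^ n = 1) :
    ∃ (m : ℕ) (r : Fin m → ℕ+)
      (ζ : (i : Fin m) → NumberField.RingOfIntegers (CyclotomicField (r i) ℚ)),
      (∀ i, IsPrimitiveRoot (ζ i) (r i : ℕ)) ∧
      ∃ F : ((i : Fin m) → NumberField.RingOfIntegers (CyclotomicField (r i) ℚ)) →ₗ[ℤ] M,
        Function.Injective F ∧ Finite (M ⧸ LinearMap.range F) ∧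
        ∀ x, F (fun i => ζ i * x i) = σ (F x) := by
  obtain rfl : ‹Module ℤ M› = AddCommGroup.toIntModule M := Subsingleton.elim _ _
  exact exists_isogeny_of_pow_eq_one σ hσ
end

section
/- Let (M, σ_M) and (N, σ_N) be free Γ-modules, with (M, σ_M) simple, and let B : M × N → ℤ be a nondegenerate Γ-equivariant ℤ-bilinear map (B(σ_M(x), σ_N(y)) = B(x, y)). Then there exist a positive integer r, a primitive r-th root of unity ζ_r in 𝓞_r = ℤ[ζ_r], and injective ℤ-linear maps with finite cokernel ψ_1 : 𝓞_r → M and ψ_2 : N → Hom_ℤ(𝓞_r, ℤ) such that ψ_1(ζ_r · x) = σ_M(ψ_1(x)) for all x ∈ 𝓞_r, ψ_2(σ_N(y))(x) = ψ_2(y)(ζ_r^{-1} · x) for all y ∈ N and x ∈ 𝓞_r, and B(ψ_1(x), y) = ψ_2(y)(x) for all x ∈ 𝓞_r, y ∈ N. That is, every simple pointwise polarizable lattice pairing over ℕ is isogenous to (ℤ[ζ_r], ℤ[ζ_r]^∨, Id) for some r. -/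
open Polynomial

/-- An additive map into a torsion-free group vanishing on a subgroup of finite index is zero. -/
theorem LinearMap.eq_zero_of_finite_quotient {M P : Type*} [AddCommGroup M] [Module ℤ M]
    [AddCommGroup P] [Module ℤ P] [Module.IsTorsionFree ℤ P] (W : Submodule ℤ M)
    [Finite (M ⧸ W)] (f : M →ₗ[ℤ] P) (hf : ∀ x ∈ W, f x = 0) : f = 0 := by
  ext x
  have hx : (Nat.card (M ⧸ W) : ℤ) • x ∈ W := by
    rw [← Submodule.Quotient.mk_eq_zero, Submodule.Quotient.mk_smul, Nat.cast_smul_eq_nsmul]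
    exact card_nsmul_eq_zero'
  have h := hf _ hx
  rw [map_zsmul, ← Int.cast_smul_eq_zsmul ℤ, smul_eq_zero] at h
  exact h.resolve_left (by simpa using (Nat.card_pos (α := M ⧸ W)).ne')

/-- An endomorphism of finite order of a nonzero module is annihilated on some nonzero vector by
some cyclotomic polynomial. -/
theorem exists_ker_aeval_cyclotomic_ne_bot {M : Type*} [AddCommGroup M] [Module ℤ M]
    [Nontrivial M] (f : Module.End ℤ M) {n : ℕ} (hn : 0 < n) (hf : f ^ n = 1) :
    ∃ r : ℕ, 0 < r ∧ LinearMap.ker (aeval f (cyclotomic r ℤ)) ≠ ⊥ := by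
  by_contra! h
  have key : ∀ s : Finset ℕ, (∀ i ∈ s, 0 < i) →
      Function.Injective (aeval f (∏ i ∈ s, cyclotomic i ℤ)) := by
    intro s
    induction s using Finset.induction_on with
    | empty => intro _; simpa using! Function.injective_id
    | insert a s ha ih =>
      intro hs
      rw [Finset.prod_insert ha, map_mul, Module.End.coe_mul]
      exact (LinearMap.ker_eq_bot.mp (h a (hs a (Finset.mem_insert_self a s)))).comp
        (ih fun i hi ↦ hs i (Finset.mem_insert_of_mem hi))
  have h0 := key n.divisors fun i hi ↦ Nat.pos_of_mem_divisors hi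
  rw [prod_cyclotomic_eq_X_pow_sub_one hn ℤ] at h0
  obtain ⟨x, hx⟩ := exists_ne (0 : M)
  exact hx (h0 (by simp [hf]))

/-- A simple endomorphism of finite order is annihilated by some cyclotomic polynomial. -/
theorem exists_aeval_cyclotomic_eq_zero {M : Type*} [AddCommGroup M] [Module ℤ M]
    [Module.IsTorsionFree ℤ M] [Nontrivial M] (f : Module.End ℤ M) {n : ℕ} (hn : 0 < n)
    (hf : f ^ n = 1)
    (hsimple : ∀ W : Submodule ℤ M, (∀ x ∈ W, f x ∈ W) → W = ⊥ ∨ Finite (M ⧸ W)) :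
    ∃ r : ℕ, 0 < r ∧ aeval f (cyclotomic r ℤ) = 0 := by
  obtain ⟨r, hr, hker⟩ := exists_ker_aeval_cyclotomic_ne_bot f hn hf
  refine ⟨r, hr, ?_⟩
  have : Finite (M ⧸ LinearMap.ker (aeval f (cyclotomic r ℤ))) := by
    refine (hsimple _ fun x hx ↦ ?_).resolve_left hker
    have hcomm : aeval f (cyclotomic r ℤ) * f = f * aeval f (cyclotomic r ℤ) := by
      simpa using congrArg (aeval f) (mul_comm (cyclotomic r ℤ) X)
    rw [LinearMap.mem_ker] at hx ⊢
    rw [← Module.End.mul_apply, hcomm, Module.End.mul_apply, hx, map_zero]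
  exact LinearMap.eq_zero_of_finite_quotient (LinearMap.ker (aeval f (cyclotomic r ℤ))) _
    fun x hx ↦ hx

/-- An action of an integral domain, algebraic over `ℤ`, on a torsion-free group has injective
orbit maps at nonzero vectors. -/
theorem injective_algHom_apply {A M : Type*} [CommRing A] [IsDomain A] [Algebra.IsAlgebraic ℤ A]
    [AddCommGroup M] [Module ℤ M] [Module.IsTorsionFree ℤ M]
    (φ : A →ₐ[ℤ] Module.End ℤ M) {m : M} (hm : m ≠ 0) :
    Function.Injective fun x ↦ φ x m := by
  intro a b hab
  by_contra hne
  obtain ⟨x, rfl⟩ : ∃ x, a = b + x := ⟨a - b, by abel⟩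
  have hx0 : x ≠ 0 := by simpa using hne
  have hx : φ x m = 0 := by simpa using hab
  obtain ⟨k, hk, y, hy⟩ := (Algebra.IsAlgebraic.isAlgebraic (R := ℤ) x).exists_nonzero_dvd
    (mem_nonZeroDivisors_of_ne_zero hx0)
  have h : φ (algebraMap ℤ A k) m = 0 := by
    rw [hy, mul_comm, map_mul, Module.End.mul_apply, hx, map_zero]
  rw [eq_intCast, map_intCast, Module.End.intCast_apply, ← Int.cast_smul_eq_zsmul ℤ,
    smul_eq_zero] at h
  exact h.elim hk hm

/-- A root of the `r`-th cyclotomic polynomial in a ring `S` is the image of a primitive `r`-th root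
of unity under a ring homomorphism to `S` from the ring of integers of any `r`-th cyclotomic
field. -/
theorem exists_algHom_ringOfIntegers_of_isCyclotomicExtension (K : Type*) [Field K] [CharZero K]
    (r : ℕ) [NeZero r] [IsCyclotomicExtension {r} ℚ K] {S : Type*} [Ring S] [Algebra ℤ S]
    (f : S) (hf : aeval f (cyclotomic r ℤ) = 0) :
    ∃ ζ : NumberField.RingOfIntegers K, IsPrimitiveRoot ζ r ∧
      ∃ φ : NumberField.RingOfIntegers K →ₐ[ℤ] S, φ ζ = f := by
  have hζ := IsCyclotomicExtension.zeta_spec r ℚ K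
  have hmin : minpoly ℤ hζ.integralPowerBasis.gen = cyclotomic r ℤ := by
    rw [hζ.integralPowerBasis_gen, cyclotomic_eq_minpoly hζ (NeZero.pos r)]
    exact (minpoly.algebraMap_eq NumberField.RingOfIntegers.coe_injective hζ.toInteger).symm
  have hgen : aeval f (minpoly ℤ hζ.integralPowerBasis.gen) = 0 := by rw [hmin, hf]
  refine ⟨hζ.toInteger, hζ.toInteger_isPrimitiveRoot,
    hζ.integralPowerBasis.lift f hgen, ?_⟩
  rw [← hζ.integralPowerBasis_gen, PowerBasis.lift_gen]

/-- Every simple pointwise polarizable lattice pairing over `ℕ` — that is,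
a nondegenerate `Γ`-equivariant pairing `B : M × N → ℤ` of free `Γ`-modules with `(M, σ_M)`
simple — is isogenous to `(ℤ[ζ_r], ℤ[ζ_r]^∨, Id)` for some `r`: there are a primitive `r`-th
root of unity `ζ_r` in the ring of integers `𝓞_r` of the `r`-th cyclotomic field and
injective `ℤ`-linear maps with finite cokernel `ψ₁ : 𝓞_r → M`, `ψ₂ : N → Hom_ℤ(𝓞_r, ℤ)`,
equivariant (the condition `ψ₂ (σ_N y) (x) = ψ₂ y (ζ_r⁻¹ x)` being recorded equivalently as
`ψ₂ (σ_N y) (ζ_r • x) = ψ₂ y x`) and compatible with the pairings. -/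
theorem stmt_15 {M N : Type*}
    [AddCommGroup M] [Module ℤ M] [Module.Free ℤ M] [Module.Finite ℤ M]
    [AddCommGroup N] [Module ℤ N] [Module.Free ℤ N] [Module.Finite ℤ N]
    (σM : M ≃ₗ[ℤ] M) (σN : N ≃ₗ[ℤ] N)
    (hσM : ∃ n : ℕ, 0 < n ∧ σM ^ n = 1) (hσN : ∃ n : ℕ, 0 < n ∧ σN ^ n = 1)
    (hMsimple : Nontrivial M ∧
      ∀ W : Submodule ℤ M, (∀ x ∈ W, σM x ∈ W) → W = ⊥ ∨ Finite (M ⧸ W))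
    (B : M →ₗ[ℤ] N →ₗ[ℤ] ℤ)
    (hBeq : ∀ x y, B (σM x) (σN y) = B x y)
    (hBnd₁ : ∀ x : M, x ≠ 0 → ∃ y, B x y ≠ 0)
    (hBnd₂ : ∀ y : N, y ≠ 0 → ∃ x, B x y ≠ 0) :
    ∃ (r : ℕ+) (ζ : NumberField.RingOfIntegers (CyclotomicField r ℚ)),
      IsPrimitiveRoot ζ (r : ℕ) ∧
      ∃ (ψ₁ : NumberField.RingOfIntegers (CyclotomicField r ℚ) →ₗ[ℤ] M)
        (ψ₂ : N →ₗ[ℤ] (NumberField.RingOfIntegers (CyclotomicField r ℚ) →ₗ[ℤ] ℤ)),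
        Function.Injective ψ₁ ∧ Finite (M ⧸ LinearMap.range ψ₁) ∧
        Function.Injective ψ₂ ∧
        Finite ((NumberField.RingOfIntegers (CyclotomicField r ℚ) →ₗ[ℤ] ℤ)
          ⧸ LinearMap.range ψ₂) ∧
        (∀ x, ψ₁ (ζ * x) = σM (ψ₁ x)) ∧
        (∀ y x, ψ₂ (σN y) (ζ * x) = ψ₂ y x) ∧
        (∀ x y, B (ψ₁ x) y = ψ₂ y x) := by
  obtain ⟨n, hn, hσn⟩ := hσM
  obtain ⟨hnt, hsimple⟩ := hMsimple
  obtain ⟨r, hr, hcyc⟩ := exists_aeval_cyclotomic_eq_zero (σM : Module.End ℤ M) hn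
    (by rw [← LinearEquiv.automorphismGroup.toLinearMapMonoidHom_apply, ← map_pow, hσn, map_one])
    hsimple
  lift r to ℕ+ using hr
  have : IsCyclotomicExtension {(r : ℕ)} ℚ (CyclotomicField r ℚ) := by
    convert! CyclotomicField.isCyclotomicExtension (r : ℕ) ℚ
  obtain ⟨ζ, hζ, φ, hφ⟩ := exists_algHom_ringOfIntegers_of_isCyclotomicExtension
    (CyclotomicField r ℚ) r _ hcyc
  obtain ⟨m, hm⟩ := exists_ne (0 : M)
  let ψ₁ : NumberField.RingOfIntegers (CyclotomicField r ℚ) →ₗ[ℤ] M :=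
    { toFun x := φ x m
      map_add' x y := by simp
      map_smul' c x := by simpa using! (int_smul_eq_zsmul ‹Module ℤ M› c (φ x m)).symm }
  have hψ₁ : Function.Injective ψ₁ := injective_algHom_apply φ hm
  have hψ₁ζ (x) : ψ₁ (ζ * x) = σM (ψ₁ x) := by
    change φ (ζ * x) m = σM (φ x m)
    rw [map_mul, hφ]
    rfl
  have hfin : Finite (M ⧸ LinearMap.range ψ₁) := by
    refine (hsimple _ ?_).resolve_left fun h ↦ hm ?_
    · rintro _ ⟨x, rfl⟩
      exact ⟨ζ * x, hψ₁ζ x⟩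
    · rw [← Submodule.mem_bot ℤ, ← h]
      exact ⟨1, by simp [ψ₁]⟩
  let ψ₂ : N →ₗ[ℤ] (NumberField.RingOfIntegers (CyclotomicField r ℚ) →ₗ[ℤ] ℤ) :=
    (B ∘ₗ ψ₁).flip
  have hψ₂ : Function.Injective ψ₂ := by
    rw [injective_iff_map_eq_zero]
    intro y hy
    by_contra hy0
    obtain ⟨x, hx⟩ := hBnd₂ y hy0
    have h : B.flip y = 0 := by
      refine LinearMap.eq_zero_of_finite_quotient (LinearMap.range ψ₁) _ ?_
      rintro _ ⟨z, rfl⟩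
      exact LinearMap.congr_fun hy z
    exact hx (LinearMap.congr_fun h x)
  have hB : Function.Injective B := by
    rw [injective_iff_map_eq_zero]
    intro x hx
    by_contra hx0
    obtain ⟨y, hy⟩ := hBnd₁ x hx0
    exact hy (by simp [hx])
  refine ⟨r, ζ, hζ, ψ₁, ψ₂, hψ₁, hfin, hψ₂, ?_, hψ₁ζ, fun y x ↦ ?_, fun _ _ ↦ rfl⟩
  · apply Submodule.finiteQuotientOfFreeOfRankEq
    refine le_antisymm (Submodule.finrank_le _) ?_
    rw [LinearMap.finrank_range_of_inj hψ₂]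
    have h := (LinearMap.finrank_le_finrank_of_injective hψ₁).trans
      (LinearMap.finrank_le_finrank_of_injective hB)
    rw [Module.finrank_linearMap_self] at h ⊢
    exact h
  · change B (ψ₁ (ζ * x)) (σN y) = B (ψ₁ x) y
    rw [hψ₁ζ, hBeq]
end
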